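/- Define the operator D₃ acting on differentiable functions of η ∈ ℝ³∖{0} by (D₃g)(η) = ‖η‖·∂_{η₃}g(η), and let Λ(η) = η₃/‖η‖. Then: (i) D₃Λ(η) = 1 − Λ(η)² for all η ≠ 0; (ii) D₃(√(1−Λ²))(η) = −Λ(η)·√(1−Λ(η)²) for all η ≠ 0 with 1−Λ(η)² > 0; and (iii) for every integer M ≥ 1 there is a constant C_M > 0 such that |D₃^M Λ(η)| ≤ C_M · (1 − Λ(η)²) for all η ≠ 0, where D₃^M denotes the M-fold iterate of D₃. -/

import Mathlib

/-- Euclidean norm on `ℝ³`. -/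
noncomputable def nrm (η : Fin 3 → ℝ) : ℝ := Real.sqrt (η 0 ^ 2 + η 1 ^ 2 + η 2 ^ 2)

/-- The dispersion relation `Λ(η) = η₃ / ‖η‖`. -/
noncomputable def Lam (η : Fin 3 → ℝ) : ℝ := η 2 / nrm η

/-- The zero-homogeneous vertical derivative `(D₃g)(η) = ‖η‖·∂_{η₃}g(η)`. -/
noncomputable def Dop (g : (Fin 3 → ℝ) → ℝ) : (Fin 3 → ℝ) → ℝ :=
  fun η => nrm η * fderiv ℝ g η (Pi.single 2 1)

/-- The square of the Euclidean norm is positive away from the origin. -/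
theorem sum_sq_pos_of_ne_zero {η : Fin 3 → ℝ} (hη : η ≠ 0) :
    0 < η 0 ^ 2 + η 1 ^ 2 + η 2 ^ 2 := by
  by_contra! h
  apply hη
  funext i
  fin_cases i <;> simp <;> nlinarith [sq_nonneg (η 0), sq_nonneg (η 1), sq_nonneg (η 2)]

theorem nrm_pos {η : Fin 3 → ℝ} (hη : η ≠ 0) : 0 < nrm η :=
  Real.sqrt_pos.2 (sum_sq_pos_of_ne_zero hη)

theorem nrm_sq (η : Fin 3 → ℝ) : nrm η ^ 2 = η 0 ^ 2 + η 1 ^ 2 + η 2 ^ 2 :=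
  Real.sq_sqrt (by positivity)

theorem Lam_sq_le_one (η : Fin 3 → ℝ) : Lam η ^ 2 ≤ 1 := by
  rw [Lam, div_pow, nrm_sq]
  exact div_le_one_of_le₀ (by nlinarith [sq_nonneg (η 0), sq_nonneg (η 1)]) (by positivity)

theorem differentiableAt_nrm {η : Fin 3 → ℝ} (hη : η ≠ 0) : DifferentiableAt ℝ nrm η :=
  DifferentiableAt.sqrt (by fun_prop) (sum_sq_pos_of_ne_zero hη).ne'

theorem differentiableAt_Lam {η : Fin 3 → ℝ} (hη : η ≠ 0) : DifferentiableAt ℝ Lam η :=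
  (differentiableAt_apply (𝕜 := ℝ) 2 η).mul ((differentiableAt_nrm hη).inv (nrm_pos hη).ne')

theorem Dop_Lam {η : Fin 3 → ℝ} (hη : η ≠ 0) : Dop Lam η = 1 - Lam η ^ 2 := by
  have hn := nrm_pos hη
  have hline : HasDerivAt (fun t : ℝ => η + t • (Pi.single 2 1 : Fin 3 → ℝ))
      (Pi.single 2 1) 0 := by
    simpa using ((hasDerivAt_id (0 : ℝ)).smul_const (Pi.single 2 1 : Fin 3 → ℝ)).const_add η
  have h₁ : HasDerivAt (fun t : ℝ => Lam (η + t • (Pi.single 2 1 : Fin 3 → ℝ)))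
      (fderiv ℝ Lam η (Pi.single 2 1)) 0 :=
    HasFDerivAt.comp_hasDerivAt (l := Lam) (l' := fderiv ℝ Lam η) (0 : ℝ)
      (by simpa using (differentiableAt_Lam hη).hasFDerivAt) hline
  have hs : HasDerivAt (fun t : ℝ => Real.sqrt (η 0 ^ 2 + η 1 ^ 2 + (η 2 + t) ^ 2))
      (η 2 / nrm η) 0 := by
    have h := ((((hasDerivAt_id' (0 : ℝ)).const_add (η 2)).fun_pow 2).const_add
      (η 0 ^ 2 + η 1 ^ 2)).sqrt (by simpa using (sum_sq_pos_of_ne_zero hη).ne')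
    refine h.congr_deriv ?_
    rw [add_zero, show Real.sqrt (η 0 ^ 2 + η 1 ^ 2 + η 2 ^ 2) = nrm η from rfl]
    field_simp
    norm_num
  have h₂ : HasDerivAt (fun t : ℝ => Lam (η + t • (Pi.single 2 1 : Fin 3 → ℝ)))
      ((nrm η - η 2 * (η 2 / nrm η)) / nrm η ^ 2) 0 := by
    have h := ((hasDerivAt_id (0 : ℝ)).const_add (η 2)).fun_div hs
      (by simpa [nrm] using hn.ne')
    simpa [Lam, nrm] using h
  rw [Dop, h₁.unique h₂, Lam]
  field_simp

/-- The chain rule for `Dop` applied to a function of `Lam`, near a nonzero frequency. -/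
theorem Dop_of_eqOn_comp_Lam {g : (Fin 3 → ℝ) → ℝ} {f : ℝ → ℝ} {f' : ℝ} {η : Fin 3 → ℝ}
    (hη : η ≠ 0) (hg : ∀ ζ, ζ ≠ 0 → g ζ = f (Lam ζ)) (hf : HasDerivAt f f' (Lam η)) :
    Dop g η = f' * (1 - Lam η ^ 2) := by
  have heq : g =ᶠ[nhds η] f ∘ Lam := by
    filter_upwards [isOpen_ne.mem_nhds hη] with ζ hζ using hg ζ hζ
  have hcomp := hf.comp_hasFDerivAt η (differentiableAt_Lam hη).hasFDerivAt
  rw [← Dop_Lam hη, Dop, Dop, heq.fderiv_eq, hcomp.fderiv]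
  simp
  ring

/-- Every positive iterate of `Dop` on `Lam` is a polynomial in `Lam` divisible by `1 - Lam²`. -/
theorem exists_polynomial_Dop_iterate_Lam (n : ℕ) :
    ∃ q : Polynomial ℝ, ∀ η : Fin 3 → ℝ, η ≠ 0 →
      Dop^[n + 1] Lam η = q.eval (Lam η) * (1 - Lam η ^ 2) := by
  induction n with
  | zero => exact ⟨1, fun η hη => by simpa using Dop_Lam hη⟩
  | succ n ih =>
    obtain ⟨q, hq⟩ := ih
    refine ⟨Polynomial.derivative (q * (1 - Polynomial.X ^ 2)), fun η hη => ?_⟩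
    rw [Function.iterate_succ_apply']
    exact Dop_of_eqOn_comp_Lam hη (fun ζ hζ => by simpa using hq ζ hζ)
      ((q * (1 - Polynomial.X ^ 2)).hasDerivAt (Lam η))

/-- Basic identities and bounds for the vertical derivative `D₃ = ‖η‖∂_{η₃}`
applied to the dispersion relation `Λ`. -/
theorem stmt18 :
    (∀ η : Fin 3 → ℝ, η ≠ 0 → Dop Lam η = 1 - Lam η ^ 2) ∧
    (∀ η : Fin 3 → ℝ, η ≠ 0 → 0 < 1 - Lam η ^ 2 →
      Dop (fun ζ => Real.sqrt (1 - Lam ζ ^ 2)) η = -Lam η * Real.sqrt (1 - Lam η ^ 2)) ∧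
    (∀ M : ℕ, 1 ≤ M → ∃ C : ℝ, 0 < C ∧ ∀ η : Fin 3 → ℝ, η ≠ 0 →
      |Dop^[M] Lam η| ≤ C * (1 - Lam η ^ 2)) := by
  refine ⟨fun η hη => Dop_Lam hη, fun η hη hpos => ?_, fun M hM => ?_⟩
  · have hf : HasDerivAt (fun x : ℝ => Real.sqrt (1 - x ^ 2)) _ (Lam η) :=
      ((hasDerivAt_pow 2 (Lam η)).const_sub 1).sqrt hpos.ne'
    rw [Dop_of_eqOn_comp_Lam hη (fun _ _ => rfl) hf]
    have hs := Real.sqrt_pos.2 hpos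
    field_simp
    rw [Real.sq_sqrt hpos.le]
    simp
  · obtain ⟨n, rfl⟩ := Nat.exists_eq_add_of_le' hM
    obtain ⟨q, hq⟩ := exists_polynomial_Dop_iterate_Lam n
    obtain ⟨C, hC⟩ := (isCompact_Icc (a := (-1 : ℝ)) (b := 1)).exists_bound_of_continuousOn
      q.continuous.continuousOn
    refine ⟨max C 1, by positivity, fun η hη => ?_⟩
    have hnonneg : 0 ≤ 1 - Lam η ^ 2 := sub_nonneg.2 (Lam_sq_le_one η)
    rw [hq η hη, abs_mul, abs_of_nonneg hnonneg]
    have hmem : Lam η ∈ Set.Icc (-1 : ℝ) 1 :=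
      abs_le.1 ((sq_le_one_iff_abs_le_one _).1 (Lam_sq_le_one η))
    gcongr
    exact (hC _ hmem).trans (le_max_left _ _)
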